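/- Let X be a Polish space and A ⊆ X. Then A is an EBP-set if and only if CR(A) ∖ A is residually null. -/

import Mathlib

open MeasureTheory Set Topology
open scoped ENNReal symmDiff

/-- The annihilator of a set `A`: the set of Borel probability measures `μ` on `X`
whose induced outer measure vanishes on `A`. -/
def Annihilator {X : Type*} [MeasurableSpace X] (A : Set X) :
    Set (ProbabilityMeasure X) :=
  {μ : ProbabilityMeasure X | μ.toMeasure A = 0}

/-- `A` is residually null if its annihilator is comeager in the space `𝓜(X)` of
Borel probability measures with the topology of weak convergence. -/
def ResiduallyNull {X : Type*} [TopologicalSpace X] [MeasurableSpace X]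
    [OpensMeasurableSpace X] (A : Set X) : Prop :=
  Annihilator A ∈ residual (ProbabilityMeasure X)

/-- `A` is an EBP-set (extended Baire property) if its symmetric difference with some
open set is residually null. -/
def EBPSet {X : Type*} [TopologicalSpace X] [MeasurableSpace X]
    [OpensMeasurableSpace X] (A : Set X) : Prop :=
  ∃ U : Set X, IsOpen U ∧ ResiduallyNull (A ∆ U)

/-- `ROp A` is the union of all open sets `U` such that `U ∩ A` is residually null. -/
def ROp {X : Type*} [TopologicalSpace X] [MeasurableSpace X]
    [OpensMeasurableSpace X] (A : Set X) : Set X :=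
  ⋃₀ {U : Set X | IsOpen U ∧ ResiduallyNull (U ∩ A)}

/-- `CROp A = X \ ROp A`. -/
def CROp {X : Type*} [TopologicalSpace X] [MeasurableSpace X]
    [OpensMeasurableSpace X] (A : Set X) : Set X :=
  (ROp A)ᶜ

theorem ResiduallyNull.mono {X : Type*} [TopologicalSpace X] [MeasurableSpace X]
    [OpensMeasurableSpace X] {A B : Set X} (hB : ResiduallyNull B) (h : A ⊆ B) :
    ResiduallyNull A :=
  Filter.mem_of_superset hB fun _ hμ => measure_mono_null h hμ

theorem ResiduallyNull.union {X : Type*} [TopologicalSpace X] [MeasurableSpace X]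
    [OpensMeasurableSpace X] {A B : Set X} (hA : ResiduallyNull A) (hB : ResiduallyNull B) :
    ResiduallyNull (A ∪ B) :=
  Filter.mem_of_superset (Filter.inter_mem hA hB) fun _ hμ => measure_union_null hμ.1 hμ.2

theorem ResiduallyNull.sUnion {X : Type*} [TopologicalSpace X] [MeasurableSpace X]
    [OpensMeasurableSpace X] {S : Set (Set X)} (hS : S.Countable)
    (h : ∀ A ∈ S, ResiduallyNull A) : ResiduallyNull (⋃₀ S) := by
  refine Filter.mem_of_superset ((countable_bInter_mem hS).2 h) fun μ hμ => ?_
  exact (measure_sUnion_null_iff hS).2 fun A hA => mem_iInter₂.1 hμ A hA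

theorem isOpen_ROp {X : Type*} [TopologicalSpace X] [MeasurableSpace X]
    [OpensMeasurableSpace X] (A : Set X) : IsOpen (ROp A) :=
  isOpen_sUnion fun _ hU => hU.1

/-- By the Lindelöf property, the residually null trace of `A` on `ROp A` is witnessed by
countably many open sets. -/
theorem residuallyNull_ROp_inter {X : Type*} [TopologicalSpace X] [SecondCountableTopology X]
    [MeasurableSpace X] [OpensMeasurableSpace X] (A : Set X) : ResiduallyNull (ROp A ∩ A) := by
  obtain ⟨T, hTc, hTS, hT⟩ := TopologicalSpace.isOpen_sUnion_countable
    {U : Set X | IsOpen U ∧ ResiduallyNull (U ∩ A)} fun _ hU => hU.1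
  refine (ResiduallyNull.sUnion (hTc.image (· ∩ A)) ?_).mono ?_
  · rintro _ ⟨U, hU, rfl⟩
    exact (hTS hU).2
  · rintro x ⟨hx, hxA⟩
    rw [ROp, ← hT] at hx
    obtain ⟨U, hU, hxU⟩ := hx
    exact ⟨U ∩ A, ⟨U, hU, rfl⟩, hxU, hxA⟩

theorem isOpen_setOf_lt_measure {X : Type*} [TopologicalSpace X] [HasOuterApproxClosed X]
    [MeasurableSpace X] [OpensMeasurableSpace X] {G : Set X} (hG : IsOpen G) (c : ℝ≥0∞) :
    IsOpen {μ : ProbabilityMeasure X | c < μ.toMeasure G} := by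
  refine isOpen_iff_eventually.2 fun μ hμ => ?_
  exact Filter.eventually_lt_of_lt_liminf
    (lt_of_lt_of_le hμ (ProbabilityMeasure.le_liminf_measure_open_of_tendsto Filter.tendsto_id hG))

/-- Probability measures not charging a measurable set with dense complement are dense: any `μ` is
the weak limit of its images under simple functions with values in the complement. -/
theorem dense_annihilator {X : Type*} [TopologicalSpace X] [PolishSpace X]
    [MeasurableSpace X] [BorelSpace X] {F : Set X} (hF : MeasurableSet F)
    (hd : Dense Fᶜ) :
    Dense (Annihilator F) := by
  intro μ
  let := TopologicalSpace.upgradeIsCompletelyMetrizable X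
  have : Nonempty X := μ.nonempty
  have : Nonempty (Fᶜ : Set X) := hd.nonempty.to_subtype
  let e : ℕ → X := fun n => (TopologicalSpace.denseSeq (Fᶜ : Set X) n : X)
  have he : DenseRange e :=
    hd.denseRange_val.comp (TopologicalSpace.denseRange_denseSeq _) continuous_subtype_val
  let f : ℕ → SimpleFunc X X := SimpleFunc.nearestPt e
  have hf : Filter.Tendsto (fun n => μ.map (f n).measurable.aemeasurable) Filter.atTop (𝓝 μ) := by
    rw [ProbabilityMeasure.tendsto_iff_forall_integral_tendsto]
    intro g
    have hmap (n : ℕ) : ∫ x, g x ∂(μ.map (f n).measurable.aemeasurable).toMeasure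
        = ∫ x, g (f n x) ∂μ.toMeasure :=
      integral_map (f n).measurable.aemeasurable g.continuous.aestronglyMeasurable
    simp_rw [hmap]
    refine tendsto_integral_of_dominated_convergence (fun _ => ‖g‖)
      (fun n => (g.continuous.measurable.comp (f n).measurable).aestronglyMeasurable)
      (integrable_const _) (fun n => .of_forall fun x => g.norm_coe_le_norm _)
      (.of_forall fun x => ?_)
    exact (g.continuous.tendsto x).comp (SimpleFunc.tendsto_nearestPt (he x))
  refine mem_closure_of_tendsto hf (.of_forall fun n => ?_)
  have hpre : f n ⁻¹' F = ∅ := by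
    ext x
    simp only [mem_preimage, mem_empty_iff_false, iff_false]
    exact (TopologicalSpace.denseSeq (Fᶜ : Set X) _).2
  change (μ.toMeasure.map (f n)) F = 0
  rw [Measure.map_apply (f n).measurable hF, hpre, measure_empty]

theorem IsClosed.residuallyNull {X : Type*} [TopologicalSpace X] [PolishSpace X]
    [MeasurableSpace X] [BorelSpace X] {F : Set X} (hF : IsClosed F) (hi : interior F = ∅) :
    ResiduallyNull F := by
  let := TopologicalSpace.upgradeIsCompletelyMetrizable X
  obtain ⟨u, -, hu1, hu⟩ := exists_seq_strictMono_tendsto' (show (0 : ℝ≥0∞) < 1 by simp)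
  have hN : Annihilator F = ⋂ n, {μ : ProbabilityMeasure X | u n < μ.toMeasure Fᶜ} := by
    ext μ
    simp only [Annihilator, mem_iInter, mem_ofPred_eq]
    rw [← prob_compl_eq_one_iff hF.measurableSet]
    refine ⟨fun h n => h ▸ (hu1 n).2, fun h => le_antisymm prob_le_one ?_⟩
    exact le_of_tendsto' hu fun n => (h n).le
  refine residual_of_dense_Gδ ?_ (dense_annihilator hF.measurableSet
    (interior_eq_empty_iff_dense_compl.1 hi))
  rw [hN]
  exact .iInter_of_isOpen fun n => isOpen_setOf_lt_measure hF.isOpen_compl (u n)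

/-- `A` is an EBP-set iff `CR(A) \ A` is residually null. -/
theorem ebp_iff_crop_diff_residuallyNull {X : Type*} [TopologicalSpace X] [PolishSpace X]
    [MeasurableSpace X] [BorelSpace X] (A : Set X) :
    EBPSet A ↔ ResiduallyNull (CROp A \ A) := by
  constructor
  · rintro ⟨U, hU, hA⟩
    have hfr : ResiduallyNull (closure U \ U) := by
      rw [← hU.frontier_eq]
      exact isClosed_frontier.residuallyNull
        (by rw [← frontier_compl]; exact interior_frontier hU.isClosed_compl)
    refine (hfr.union hA).mono ?_
    rintro x ⟨hx, hxA⟩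
    by_cases hxU : x ∈ U
    · exact Or.inr (Or.inr ⟨hxU, hxA⟩)
    · refine Or.inl ⟨?_, hxU⟩
      by_contra hxc
      refine hx ⟨(closure U)ᶜ, ⟨isClosed_closure.isOpen_compl, hA.mono ?_⟩, hxc⟩
      exact fun y hy => Or.inl ⟨hy.2, fun h => hy.1 (subset_closure h)⟩
  · intro h
    have hc : IsClosed (CROp A) := (isOpen_ROp A).isClosed_compl
    refine ⟨interior (CROp A), isOpen_interior, ?_⟩
    refine ((h.union (residuallyNull_ROp_inter A)).union
      (isClosed_frontier.residuallyNull (interior_frontier hc))).mono ?_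
    rintro x (⟨hxA, hx⟩ | ⟨hx, hxA⟩)
    · by_cases hxR : x ∈ ROp A
      · exact Or.inl (Or.inr ⟨hxR, hxA⟩)
      · exact Or.inr ⟨subset_closure hxR, hx⟩
    · exact Or.inl (Or.inl ⟨interior_subset hx, hxA⟩)
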